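/- Suppose the dealer is a member of the Vamos pair C (e.g., the dealer is v6, so the access structure is V6 = Γ_{v6}). Then for any perfect secret sharing scheme, 2/17 ≤ λ. -/

import Mathlib

open MeasureTheory Finset

/-- Shannon entropy of a random variable with values in a finite type:
`H(f) = ∑ₐ −P(f = a)·log P(f = a)`. -/
noncomputable def shannonEntropy {Ω : Type} [MeasurableSpace Ω] {α : Type} [Fintype α]
    (μ : Measure Ω) (f : Ω → α) : ℝ :=
  ∑ a : α, Real.negMulLog ((μ (f ⁻¹' {a})).toReal)

/-- A family of random variables on a common probability space: one (finite-valued)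
random variable `secret` for the secret, and one random variable `share p` for the
share of each participant `p`. -/
structure Scheme (P : Type) [Fintype P] [DecidableEq P] where
  (Ω : Type)
  [mΩ : MeasurableSpace Ω]
  (μ : Measure Ω)
  [prob : IsProbabilityMeasure μ]
  (SecT : Type)
  [secFin : Fintype SecT]
  (ShT : P → Type)
  [shFin : ∀ p, Fintype (ShT p)]
  (secret : Ω → SecT)
  (share : (p : P) → Ω → ShT p)
  (secret_meas : ∀ s : Set SecT, MeasurableSet (secret ⁻¹' s))
  (share_meas : ∀ p, ∀ s : Set (ShT p), MeasurableSet (share p ⁻¹' s))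

namespace Scheme

variable {P : Type} [Fintype P] [DecidableEq P]

/-- `H(S)`: the entropy of the secret. -/
noncomputable def Hsec (S : Scheme P) : ℝ :=
  letI := S.mΩ; letI := S.secFin
  shannonEntropy S.μ S.secret

/-- `H(X)`: the joint entropy of the shares of the participants in `X`. -/
noncomputable def Hset (S : Scheme P) (X : Finset P) : ℝ :=
  letI := S.mΩ; letI := S.shFin
  shannonEntropy S.μ (fun ω => fun p : {y // y ∈ X} => S.share p.1 ω)

/-- `H(X ∪ {S})`: the joint entropy of the shares of the participants in `X`
together with the secret. -/
noncomputable def HsetS (S : Scheme P) (X : Finset P) : ℝ :=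
  letI := S.mΩ; letI := S.secFin; letI := S.shFin
  shannonEntropy S.μ (fun ω => ((fun p : {y // y ∈ X} => S.share p.1 ω), S.secret ω))

/-- The normalized entropy `h(X) = H(X)/H(S)`. -/
noncomputable def hset (S : Scheme P) (X : Finset P) : ℝ := S.Hset X / S.Hsec

/-- The conditional normalized entropy `h(X|Y) = h(X ∪ Y) − h(Y)`. -/
noncomputable def hcond (S : Scheme P) (X Y : Finset P) : ℝ :=
  S.hset (X ∪ Y) - S.hset Y

/-- `Σ` is a perfect secret sharing scheme for the access structure `Γ`:
the conditional entropy `H(S|X) = H(X ∪ {S}) − H(X)` equals `0` for every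
qualified set `X` and equals `H(S)` for every unqualified set `X`. -/
def IsPerfect (S : Scheme P) (Γ : Finset P → Prop) : Prop :=
  (∀ X : Finset P, Γ X → S.HsetS X - S.Hset X = 0) ∧
  (∀ X : Finset P, ¬ Γ X → S.HsetS X - S.Hset X = S.Hsec)

end Scheme
/-- The four Vamos pairs `A = {v₁,v₂}`, `B = {v₃,v₄}`, `C = {v₅,v₆}`, `D = {v₇,v₈}`,
where participant `vᵢ` is represented by `(i-1 : Fin 8)`. -/
def pairA : Finset (Fin 8) := {0, 1}
def pairB : Finset (Fin 8) := {2, 3}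
def pairC : Finset (Fin 8) := {4, 5}
def pairD : Finset (Fin 8) := {6, 7}

/-- `X` is one of the four Vamos pairs. -/
def IsVamosPair (X : Finset (Fin 8)) : Prop :=
  X = pairA ∨ X = pairB ∨ X = pairC ∨ X = pairD

/-- The dependent sets of the Vamos matroid: the five special four-element sets
`AB`, `AC`, `BC`, `BD`, `CD`, and all sets with at least five elements. -/
def VamosDep (X : Finset (Fin 8)) : Prop :=
  X = pairA ∪ pairB ∨ X = pairA ∪ pairC ∨ X = pairB ∪ pairC ∨
    X = pairB ∪ pairD ∨ X = pairC ∪ pairD ∨ 5 ≤ X.card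

/-- The circuits of the Vamos matroid: minimal dependent sets. -/
def VamosCircuit (X : Finset (Fin 8)) : Prop :=
  VamosDep X ∧ ∀ Y ⊂ X, ¬ VamosDep Y

/-- The access structure `Γₓ` induced by the Vamos matroid with dealer `x`
(the dealer is regarded as a participant who is individually qualified):
a set is qualified iff it contains a minimal qualified set, the minimal
qualified sets being `{x}` and the sets `M ⊆ Q \ {x}` with `M ∪ {x}` a circuit. -/
def VamosQualified (x : Fin 8) (Y : Finset (Fin 8)) : Prop :=
  x ∈ Y ∨ ∃ M ⊆ Y, x ∉ M ∧ VamosCircuit (insert x M)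

/-- `λ = (max₁≤ᵢ≤₈ h({vᵢ})) − 1`. -/
noncomputable def Scheme.lam (S : Scheme (Fin 8)) : ℝ :=
  (Finset.univ.sup' Finset.univ_nonempty fun i : Fin 8 => S.hset {i}) - 1

/-- The information rate `ρ(Σ) = min₁≤ᵢ≤₈ H(S)/H(vᵢ)` of a scheme. -/
noncomputable def Scheme.rho (S : Scheme (Fin 8)) : ℝ :=
  Finset.univ.inf' Finset.univ_nonempty fun i : Fin 8 => S.Hsec / S.Hset {i}

/-- The probability, under the mass function `p`, of the event that `f` takes the same value as
at `ω`. -/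
noncomputable def fiberMass {Ω α : Type} [Fintype Ω] (p : Ω → ℝ) (f : Ω → α) (ω : Ω) : ℝ :=
  open Classical in ∑ η, if f η = f ω then p η else 0

/-- The Shannon entropy of `f` under the mass function `p`, as the expected information content. -/
noncomputable def massEntropy {Ω α : Type} [Fintype Ω] (p : Ω → ℝ) (f : Ω → α) : ℝ :=
  ∑ ω, p ω * -Real.log (fiberMass p f ω)

section MassEntropy

variable {Ω α β γ δ : Type} [Fintype Ω] {p : Ω → ℝ}

theorem le_fiberMass (hp : ∀ ω, 0 ≤ p ω) (f : Ω → α) (ω : Ω) : p ω ≤ fiberMass p f ω := by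
  classical
  unfold fiberMass
  have := Finset.single_le_sum (f := fun η => if f η = f ω then p η else 0)
    (fun η _ => by split_ifs <;> simp [hp]) (Finset.mem_univ ω)
  simpa using this

theorem fiberMass_mono (hp : ∀ ω, 0 ≤ p ω) {f : Ω → α} {g : Ω → β}
    (hfg : ∀ ω η, p ω ≠ 0 → p η ≠ 0 → f η = f ω → g η = g ω) {ω : Ω} (hω : p ω ≠ 0) :
    fiberMass p f ω ≤ fiberMass p g ω := by
  classical
  refine Finset.sum_le_sum fun η _ => ?_
  by_cases hη : p η = 0
  · simp [hη]
  by_cases h : f η = f ω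
  · simp [h, hfg ω η hω hη h]
  · simp only [h, if_false]
    split_ifs <;> simp [hp]

theorem fiberMass_congr {f : Ω → α} {ω η : Ω} (h : f ω = f η) :
    fiberMass p f ω = fiberMass p f η := by
  unfold fiberMass
  rw [h]

/-- A function of a random variable, almost surely, has at most its entropy. -/
theorem massEntropy_mono (hp : ∀ ω, 0 ≤ p ω) {f : Ω → α} {g : Ω → β}
    (hfg : ∀ ω η, p ω ≠ 0 → p η ≠ 0 → f η = f ω → g η = g ω) :
    massEntropy p g ≤ massEntropy p f := by
  refine Finset.sum_le_sum fun ω _ => ?_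
  by_cases hω : p ω = 0
  · simp [hω]
  have hpos : 0 < p ω := lt_of_le_of_ne (hp ω) (Ne.symm hω)
  exact mul_le_mul_of_nonneg_left (neg_le_neg (Real.log_le_log
    (hpos.trans_le (le_fiberMass hp f ω)) (fiberMass_mono hp hfg hω))) (hp ω)

theorem massEntropy_congr (hp : ∀ ω, 0 ≤ p ω) {f : Ω → α} {g : Ω → β}
    (hfg : ∀ ω η, p ω ≠ 0 → p η ≠ 0 → (f η = f ω ↔ g η = g ω)) :
    massEntropy p f = massEntropy p g :=
  le_antisymm (massEntropy_mono hp fun ω η hω hη => (hfg ω η hω hη).2)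
    (massEntropy_mono hp fun ω η hω hη => (hfg ω η hω hη).1)

theorem massEntropy_eq_zero (hsum : ∑ ω, p ω = 1) {f : Ω → α} (hf : ∀ ω η, f ω = f η) :
    massEntropy p f = 0 := by
  have h (ω : Ω) : fiberMass p f ω = 1 := by
    simp [fiberMass, hf _ ω, hsum]
  simp [massEntropy, h]

theorem sum_mul_div_fiberMass_le (hp : ∀ ω, 0 ≤ p ω) {f : Ω → α} {g : Ω → β} {k : Ω → γ}
    (hfk : ∀ ω η, f η = f ω → k η = k ω) (hgk : ∀ ω η, g η = g ω → k η = k ω) :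
    ∑ ω, p ω * (fiberMass p f ω * fiberMass p g ω /
      (fiberMass p (fun ω => (f ω, g ω)) ω * fiberMass p k ω)) ≤ ∑ ω, p ω := by
  classical
  set J := fiberMass p (fun ω => (f ω, g ω)) with hJ
  set K := fiberMass p k with hK
  have hKnn (ω : Ω) : 0 ≤ K ω := (hp ω).trans (le_fiberMass hp k ω)
  have hJnn (ω : Ω) : 0 ≤ J ω := (hp ω).trans (le_fiberMass hp _ ω)
  have expand : ∑ ω, p ω * (fiberMass p f ω * fiberMass p g ω / (J ω * K ω)) =
      ∑ η, ∑ ζ, ∑ ω, if f η = f ω ∧ g ζ = g ω then p η * p ζ * (p ω / (J ω * K ω)) else 0 := by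
    have : ∀ ω, p ω * (fiberMass p f ω * fiberMass p g ω / (J ω * K ω)) =
        ∑ η, ∑ ζ, if f η = f ω ∧ g ζ = g ω then p η * p ζ * (p ω / (J ω * K ω)) else 0 := by
      intro ω
      have : p ω * (fiberMass p f ω * fiberMass p g ω / (J ω * K ω)) =
        (fiberMass p f ω * fiberMass p g ω) * (p ω / (J ω * K ω)) := by ring
      rw [this, fiberMass, fiberMass, Finset.sum_mul_sum, Finset.sum_mul]
      refine Finset.sum_congr rfl fun η _ => ?_
      rw [Finset.sum_mul]
      refine Finset.sum_congr rfl fun ζ _ => ?_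
      by_cases h1 : f η = f ω <;> by_cases h2 : g ζ = g ω <;> simp [h1, h2]
    simp_rw [this]
    rw [Finset.sum_comm]
    exact Finset.sum_congr rfl fun η _ => Finset.sum_comm
  have inner (η ζ : Ω) :
      (∑ ω, if f η = f ω ∧ g ζ = g ω then p η * p ζ * (p ω / (J ω * K ω)) else 0) ≤
        if k ζ = k η then p η * p ζ / K η else 0 := by
    by_cases hex : ∃ θ, f η = f θ ∧ g ζ = g θ
    · obtain ⟨θ, hθf, hθg⟩ := hex
      have hk1 : k η = k θ := hfk _ _ hθf
      have hk : k ζ = k η := (hgk _ _ hθg).trans hk1.symm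
      rw [if_pos hk]
      have hsum : (∑ ω, if f η = f ω ∧ g ζ = g ω then p η * p ζ * (p ω / (J ω * K ω)) else 0) =
          p η * p ζ / K η * (J θ / J θ) := by
        have hJθ : J θ = ∑ ω, if f η = f ω ∧ g ζ = g ω then p ω else 0 := by
          rw [hJ]
          unfold fiberMass
          refine Finset.sum_congr rfl fun ω _ => ?_
          simp only [Prod.mk.injEq, hθf, hθg, eq_comm]
        rw [← mul_div_assoc]
        conv_rhs => enter [1]; rw [hJθ, Finset.mul_sum]
        rw [Finset.sum_div]
        refine Finset.sum_congr rfl fun ω _ => ?_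
        split_ifs with h
        · have hJω : J ω = J θ := fiberMass_congr (by simp [← h.1, ← h.2, hθf, hθg])
          have hKω : K ω = K η := fiberMass_congr (hfk _ _ h.1.symm)
          rw [hJω, hKω]
          ring
        · simp
      rw [hsum]
      exact mul_le_of_le_one_right (div_nonneg (mul_nonneg (hp _) (hp _)) (hKnn _))
        (div_self_le_one _)
    · push Not at hex
      rw [Finset.sum_eq_zero fun ω _ => if_neg fun h => hex ω h.1 h.2]
      split_ifs
      · exact div_nonneg (mul_nonneg (hp _) (hp _)) (hKnn _)
      · rfl
  rw [expand]
  refine (Finset.sum_le_sum fun η _ => Finset.sum_le_sum fun ζ _ => inner η ζ).trans ?_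
  refine Finset.sum_le_sum fun η _ => ?_
  have : (∑ ζ, if k ζ = k η then p η * p ζ / K η else 0) = p η * (K η / K η) := by
    rw [← mul_div_assoc]
    conv_rhs => enter [1]; rw [hK, fiberMass, Finset.mul_sum]
    rw [Finset.sum_div]
    refine Finset.sum_congr rfl fun ζ _ => ?_
    split_ifs <;> simp
  rw [this]
  exact mul_le_of_le_one_right (hp _) (div_self_le_one _)

theorem massEntropy_submodular_pair (hp : ∀ ω, 0 ≤ p ω) {f : Ω → α} {g : Ω → β} {k : Ω → γ}
    (hfk : ∀ ω η, f η = f ω → k η = k ω) (hgk : ∀ ω η, g η = g ω → k η = k ω) :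
    massEntropy p (fun ω => (f ω, g ω)) + massEntropy p k ≤ massEntropy p f + massEntropy p g := by
  have key : ∑ ω, p ω * (Real.log (fiberMass p f ω) + Real.log (fiberMass p g ω)
      - Real.log (fiberMass p (fun ω => (f ω, g ω)) ω) - Real.log (fiberMass p k ω)) ≤ 0 := by
    have hle := sum_mul_div_fiberMass_le hp hfk hgk
    have : ∑ ω, p ω * (Real.log (fiberMass p f ω) + Real.log (fiberMass p g ω)
        - Real.log (fiberMass p (fun ω => (f ω, g ω)) ω) - Real.log (fiberMass p k ω)) ≤
        ∑ ω, (p ω * (fiberMass p f ω * fiberMass p g ω /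
          (fiberMass p (fun ω => (f ω, g ω)) ω * fiberMass p k ω)) - p ω) := by
      refine Finset.sum_le_sum fun ω _ => ?_
      by_cases hω : p ω = 0
      · simp [hω]
      have hpos : 0 < p ω := lt_of_le_of_ne (hp ω) (Ne.symm hω)
      have hf := hpos.trans_le (le_fiberMass hp f ω)
      have hg := hpos.trans_le (le_fiberMass hp g ω)
      have hk := hpos.trans_le (le_fiberMass hp k ω)
      have hfg := hpos.trans_le (le_fiberMass hp (fun ω => (f ω, g ω)) ω)
      have hlog := Real.log_le_sub_one_of_pos (div_pos (mul_pos hf hg) (mul_pos hfg hk))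
      rw [Real.log_div (by positivity) (by positivity), Real.log_mul hf.ne' hg.ne',
        Real.log_mul hfg.ne' hk.ne'] at hlog
      nlinarith
    rw [Finset.sum_sub_distrib] at this
    linarith
  have split : ∑ ω, p ω * (Real.log (fiberMass p f ω) + Real.log (fiberMass p g ω)
      - Real.log (fiberMass p (fun ω => (f ω, g ω)) ω) - Real.log (fiberMass p k ω)) =
      massEntropy p (fun ω => (f ω, g ω)) + massEntropy p k
        - massEntropy p f - massEntropy p g := by
    simp only [massEntropy, ← Finset.sum_add_distrib, ← Finset.sum_sub_distrib]
    exact Finset.sum_congr rfl fun ω _ => by ring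
  linarith

/-- Submodularity: `H(u) + H(k) ≤ H(f) + H(g)` when `u` is a function of `(f, g)` and `k` is a
function of `f` and of `g`. -/
theorem massEntropy_submodular (hp : ∀ ω, 0 ≤ p ω) {f : Ω → α} {g : Ω → β} {k : Ω → γ}
    {u : Ω → δ} (hfk : ∀ ω η, f η = f ω → k η = k ω) (hgk : ∀ ω η, g η = g ω → k η = k ω)
    (hu : ∀ ω η, f η = f ω → g η = g ω → u η = u ω) :
    massEntropy p u + massEntropy p k ≤ massEntropy p f + massEntropy p g := by
  have h1 := massEntropy_submodular_pair hp hfk hgk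
  have h2 : massEntropy p u ≤ massEntropy p (fun ω => (f ω, g ω)) :=
    massEntropy_mono hp fun ω η _ _ h => hu ω η (Prod.ext_iff.1 h).1 (Prod.ext_iff.1 h).2
  linarith

/-- The joint law of two copies of `p` that agree on `f` and are conditionally independent
given `f`. -/
noncomputable def copyMass (p : Ω → ℝ) (f : Ω → α) (w : Ω × Ω) : ℝ :=
  open Classical in if f w.2 = f w.1 then p w.1 * p w.2 / fiberMass p f w.1 else 0

theorem copyMass_nonneg (hp : ∀ ω, 0 ≤ p ω) (f : Ω → α) (w : Ω × Ω) : 0 ≤ copyMass p f w := by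
  unfold copyMass
  split_ifs
  · exact div_nonneg (mul_nonneg (hp _) (hp _)) ((hp _).trans (le_fiberMass hp f _))
  · rfl

theorem copyMass_swap (f : Ω → α) (w : Ω × Ω) : copyMass p f w.swap = copyMass p f w := by
  unfold copyMass
  by_cases h : f w.2 = f w.1
  · simp [h, fiberMass_congr h, mul_comm]
  · simp [h, Ne.symm h]

theorem eq_of_copyMass_ne_zero {f : Ω → α} {w : Ω × Ω} (h : copyMass p f w ≠ 0) :
    f w.2 = f w.1 := by
  by_contra hne
  exact h (if_neg hne)

theorem sum_copyMass (hp : ∀ ω, 0 ≤ p ω) (f : Ω → α) (ω : Ω) :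
    ∑ η, copyMass p f (ω, η) = p ω := by
  classical
  by_cases hω : p ω = 0
  · simp [copyMass, hω]
  have hpos : 0 < p ω := lt_of_le_of_ne (hp ω) (Ne.symm hω)
  have hF : fiberMass p f ω ≠ 0 := (hpos.trans_le (le_fiberMass hp f ω)).ne'
  have : ∑ η, copyMass p f (ω, η) = p ω * fiberMass p f ω / fiberMass p f ω := by
    conv_rhs => enter [1]; rw [fiberMass, Finset.mul_sum]
    rw [Finset.sum_div]
    refine Finset.sum_congr rfl fun η _ => ?_
    simp only [copyMass]
    split_ifs <;> simp
  rw [this, mul_div_cancel_right₀ _ hF]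

theorem fiberMass_copyMass_fst (hp : ∀ ω, 0 ≤ p ω) (f : Ω → α) (g : Ω → β) (w : Ω × Ω) :
    fiberMass (copyMass p f) (fun w => g w.1) w = fiberMass p g w.1 := by
  classical
  unfold fiberMass
  rw [Fintype.sum_prod_type]
  refine Finset.sum_congr rfl fun ω _ => ?_
  dsimp only
  split_ifs
  · exact sum_copyMass hp f ω
  · simp

theorem massEntropy_copyMass_fst (hp : ∀ ω, 0 ≤ p ω) (f : Ω → α) (g : Ω → β) :
    massEntropy (copyMass p f) (fun w => g w.1) = massEntropy p g := by
  simp only [massEntropy, fiberMass_copyMass_fst hp]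
  rw [Fintype.sum_prod_type]
  refine Finset.sum_congr rfl fun ω _ => ?_
  dsimp only
  rw [← Finset.sum_mul, sum_copyMass hp f ω]

theorem fiberMass_copyMass_swap (f : Ω → α) (g : Ω × Ω → β) (w : Ω × Ω) :
    fiberMass (copyMass p f) (fun w => g w.swap) w = fiberMass (copyMass p f) g w.swap := by
  classical
  unfold fiberMass
  rw [← (Equiv.prodComm Ω Ω).sum_comp]
  refine Finset.sum_congr rfl fun v _ => ?_
  simp [copyMass_swap]

theorem massEntropy_copyMass_snd (hp : ∀ ω, 0 ≤ p ω) (f : Ω → α) (g : Ω → β) :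
    massEntropy (copyMass p f) (fun w => g w.2) = massEntropy p g := by
  rw [← massEntropy_copyMass_fst hp f g]
  simp only [massEntropy]
  rw [← (Equiv.prodComm Ω Ω).sum_comp]
  refine Finset.sum_congr rfl fun w _ => ?_
  rw [Equiv.prodComm_apply, copyMass_swap, ← fiberMass_copyMass_swap]
  rfl

theorem massEntropy_copyMass_id (hp : ∀ ω, 0 ≤ p ω) (f : Ω → α) :
    massEntropy (copyMass p f) id + massEntropy p f = massEntropy p id + massEntropy p id := by
  have hid {Ω' : Type} [Fintype Ω'] (q : Ω' → ℝ) (w : Ω') : fiberMass q id w = q w := by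
    unfold fiberMass
    rw [Finset.sum_eq_single w] <;> simp +contextual
  nth_rewrite 2 [← massEntropy_copyMass_snd hp f id]
  rw [← massEntropy_copyMass_fst hp f id, ← massEntropy_copyMass_fst hp f f]
  simp only [massEntropy, ← Finset.sum_add_distrib]
  refine Finset.sum_congr rfl fun w _ => ?_
  by_cases hw : copyMass p f w = 0
  · simp [hw]
  have hmul : p w.1 * p w.2 / fiberMass p f w.1 = copyMass p f w :=
    (if_pos (eq_of_copyMass_ne_zero hw)).symm
  have hn : p w.1 * p w.2 / fiberMass p f w.1 ≠ 0 := hmul ▸ hw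
  have hF : fiberMass p f w.1 ≠ 0 := fun h => hn (by simp [h])
  have ha : p w.1 ≠ 0 := fun h => hn (by simp [h])
  have hb : p w.2 ≠ 0 := fun h => hn (by simp [h])
  have hsnd : fiberMass (copyMass p f) (fun w => id w.2) w = p w.2 := by
    have h := fiberMass_copyMass_swap (p := p) f (fun w => id w.1) w
    rw [fiberMass_copyMass_fst hp, hid] at h
    exact h
  rw [fiberMass_copyMass_fst hp, fiberMass_copyMass_fst hp, hid, hid, hsnd, ← hmul,
    Real.log_div (mul_ne_zero ha hb) hF, Real.log_mul ha hb]
  ring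

/-- In the copy, a function `u` of the first component and a function `v` of the second component
share at most the information carried by `f`. -/
theorem massEntropy_copyMass_condIndep (hp : ∀ ω, 0 ≤ p ω) {f : Ω → α} {u : Ω → β} {v : Ω → γ}
    {j : Ω × Ω → δ}
    (hj : ∀ w z, copyMass p f w ≠ 0 → copyMass p f z ≠ 0 → j z = j w → u z.1 = u w.1 ∧ v z.2 = v w.2) :
    massEntropy p u + massEntropy p v ≤ massEntropy (copyMass p f) j + massEntropy p f := by
  have hq := copyMass_nonneg hp f
  have h1 := massEntropy_submodular hq (f := fun w : Ω × Ω => w.1)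
    (g := fun w => (u w.1, v w.2)) (k := fun w => u w.1) (u := fun w => (w.1, v w.2))
    (fun w z h => by simp_all) (fun w z h => (Prod.ext_iff.1 h).1)
    (fun w z h h' => by simp_all)
  have h2 := massEntropy_submodular hq (f := fun w : Ω × Ω => (w.1, v w.2))
    (g := fun w => w.2) (k := fun w => v w.2) (u := id)
    (fun w z h => (Prod.ext_iff.1 h).2) (fun w z h => by simp_all)
    (fun w z h h' => Prod.ext (Prod.ext_iff.1 h).1 h')
  have h3 : massEntropy (copyMass p f) (fun w => (u w.1, v w.2)) ≤ massEntropy (copyMass p f) j :=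
    massEntropy_mono hq fun w z hw hz h => Prod.ext (hj w z hw hz h).1 (hj w z hw hz h).2
  have h4 := massEntropy_copyMass_id hp f
  have h5 := massEntropy_copyMass_fst hp f u
  have h6 := massEntropy_copyMass_snd hp f v
  have h7 := massEntropy_copyMass_fst hp f id
  have h8 := massEntropy_copyMass_snd hp f id
  simp only [id] at h7 h8
  change massEntropy (copyMass p f) (fun w => w.1) = massEntropy p id at h7
  change massEntropy (copyMass p f) (fun w => w.2) = massEntropy p id at h8
  linarith

end MassEntropy

/-- The joint variable of those `X i` for which the bit `i` of `m` is set. -/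
def maskVar {Ω V : Type} (X : ℕ → Ω → V) (m : ℕ) (ω : Ω) (i : ℕ) : Option V :=
  if m.testBit i then some (X i ω) else none

section MaskVar

variable {Ω V : Type} {X : ℕ → Ω → V}

theorem maskVar_eq_iff {m : ℕ} {ω η : Ω} :
    maskVar X m η = maskVar X m ω ↔ ∀ i, m.testBit i → X i η = X i ω := by
  refine funext_iff.trans (forall_congr' fun i => ?_)
  unfold maskVar
  split_ifs with h <;> simp [h]

variable [Fintype Ω] {p : Ω → ℝ}

theorem massEntropy_maskVar_zero (hsum : ∑ ω, p ω = 1) : massEntropy p (maskVar X 0) = 0 :=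
  massEntropy_eq_zero hsum fun ω η => maskVar_eq_iff.2 (by simp)

theorem massEntropy_maskVar_mono (hp : ∀ ω, 0 ≤ p ω) {m n : ℕ} (h : m &&& n = m) :
    massEntropy p (maskVar X m) ≤ massEntropy p (maskVar X n) := by
  refine massEntropy_mono hp fun ω η _ _ he => ?_
  rw [maskVar_eq_iff] at he ⊢
  intro i hi
  rw [← h, Nat.testBit_land, Bool.and_eq_true] at hi
  exact he i hi.2

theorem massEntropy_maskVar_submodular (hp : ∀ ω, 0 ≤ p ω) {m n u v : ℕ} (hu : m ||| n = u)
    (hv : m &&& n = v) :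
    massEntropy p (maskVar X u) + massEntropy p (maskVar X v) ≤
      massEntropy p (maskVar X m) + massEntropy p (maskVar X n) := by
  subst hu hv
  refine massEntropy_submodular hp (fun ω η h => ?_) (fun ω η h => ?_) (fun ω η h h' => ?_)
  all_goals
    simp only [maskVar_eq_iff, Nat.testBit_land, Nat.testBit_lor, Bool.and_eq_true,
      Bool.or_eq_true] at *
    grind

end MaskVar

theorem lt_of_testBit_of_lt {m i k : ℕ} (hm : m < 2 ^ k) (h : m.testBit i = true) : i < k := by
  by_contra! hle
  rw [Nat.testBit_lt_two_pow (hm.trans_le (Nat.pow_le_pow_right two_pos hle))] at h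
  exact absurd h (by decide)

theorem testBit_sixty {i : ℕ} : (60 : ℕ).testBit i = true ↔ 2 ≤ i ∧ i < 6 := by
  constructor
  · intro h
    have hi : i < 6 := lt_of_testBit_of_lt (by decide) h
    interval_cases i <;> simp_all +decide
  · rintro ⟨h2, h6⟩
    interval_cases i <;> decide

theorem testBit_three {i : ℕ} : (3 : ℕ).testBit i = true ↔ i < 2 := by
  constructor
  · exact lt_of_testBit_of_lt (by decide)
  · intro h
    interval_cases i <;> decide

/-- Eight variables evaluated at the first component, followed by the same variables evaluated at
the second component. -/
def copyVar {Ω V : Type} (X : ℕ → Ω → V) (i : ℕ) (w : Ω × Ω) : V :=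
  if i < 8 then X i w.1 else X (i - 8) w.2

section CopyVar

variable {Ω V : Type} [Fintype Ω] {p : Ω → ℝ} {X : ℕ → Ω → V}

theorem massEntropy_copyVar_base (hp : ∀ ω, 0 ≤ p ω) {m : ℕ} (hm : m < 256) :
    massEntropy (copyMass p (maskVar X 60)) (maskVar (copyVar X) m) =
      massEntropy p (maskVar X m) := by
  rw [← massEntropy_copyMass_fst hp (maskVar X 60) (maskVar X m)]
  refine massEntropy_congr (copyMass_nonneg hp _) fun w z _ _ => ?_
  simp only [maskVar_eq_iff]
  refine forall_congr' fun i => forall_congr' fun hi => ?_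
  have h8 : i < 8 := lt_of_testBit_of_lt hm hi
  simp [copyVar, h8]

theorem apply_eq_of_copyMass_ne_zero {w : Ω × Ω} (hw : copyMass p (maskVar X 60) w ≠ 0) {i : ℕ}
    (h2 : 2 ≤ i) (h6 : i < 6) : X i w.2 = X i w.1 :=
  maskVar_eq_iff.1 (eq_of_copyMass_ne_zero hw) i (testBit_sixty.2 ⟨h2, h6⟩)

theorem massEntropy_copyVar_copy (hp : ∀ ω, 0 ≤ p ω) {m n : ℕ} (hm : m < 64)
    (hn : (m &&& 60) ||| ((m &&& 3) <<< 8) = n) :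
    massEntropy (copyMass p (maskVar X 60)) (maskVar (copyVar X) n) =
      massEntropy p (maskVar X m) := by
  rw [← massEntropy_copyMass_snd hp (maskVar X 60) (maskVar X m)]
  refine massEntropy_congr (copyMass_nonneg hp _) fun w z hw hz => ?_
  simp only [maskVar_eq_iff]
  have hbit (i : ℕ) : n.testBit i = true ↔
      (m.testBit i = true ∧ 2 ≤ i ∧ i < 6) ∨ (8 ≤ i ∧ m.testBit (i - 8) = true ∧ i - 8 < 2) := by
    rw [← hn]
    simp only [Nat.testBit_lor, Nat.testBit_land, Nat.testBit_shiftLeft, Bool.or_eq_true,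
      Bool.and_eq_true, testBit_sixty, testBit_three, decide_eq_true_eq, ge_iff_le]
  constructor
  · intro h i hi
    have h6 : i < 6 := lt_of_testBit_of_lt hm hi
    by_cases h2 : 2 ≤ i
    · have := h i ((hbit i).2 (Or.inl ⟨hi, h2, h6⟩))
      simp only [copyVar, show i < 8 by lia, if_true] at this
      rw [apply_eq_of_copyMass_ne_zero hw h2 h6, apply_eq_of_copyMass_ne_zero hz h2 h6, this]
    · have := h (i + 8) ((hbit _).2 (Or.inr ⟨by lia, by simpa using hi, by lia⟩))
      simpa [copyVar] using this
  · intro h i hi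
    rcases (hbit i).1 hi with ⟨hmi, h2, h6⟩ | ⟨h8, hmi, -⟩
    · simp only [copyVar, show i < 8 by lia, if_true]
      rw [← apply_eq_of_copyMass_ne_zero hw h2 h6, ← apply_eq_of_copyMass_ne_zero hz h2 h6]
      exact h i hmi
    · simpa [copyVar, show ¬ i < 8 by lia] using h _ hmi

theorem massEntropy_copyVar_condIndep (hp : ∀ ω, 0 ≤ p ω) :
    massEntropy p (maskVar X 63) + massEntropy p (maskVar X 255) ≤
      massEntropy (copyMass p (maskVar X 60)) (maskVar (copyVar X) 1023) +
        massEntropy p (maskVar X 60) := by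
  rw [add_comm]
  refine massEntropy_copyMass_condIndep hp fun w z hw hz h => ?_
  rw [maskVar_eq_iff] at h
  have hbit {i : ℕ} (hi : i < 10) : (1023 : ℕ).testBit i = true := by
    interval_cases i <;> decide
  have hfst {i : ℕ} (hi : i < 8) : X i z.1 = X i w.1 := by
    simpa [copyVar, hi] using h i (hbit (by lia))
  refine ⟨maskVar_eq_iff.2 fun i hi => hfst (lt_of_testBit_of_lt (by decide) hi),
    maskVar_eq_iff.2 fun i hi => ?_⟩
  have h6 : i < 6 := lt_of_testBit_of_lt (by decide) hi
  by_cases h2 : 2 ≤ i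
  · rw [apply_eq_of_copyMass_ne_zero hw h2 h6, apply_eq_of_copyMass_ne_zero hz h2 h6]
    exact hfst (by lia)
  · simpa [copyVar] using h (i + 8) (hbit (by lia))

end CopyVar

theorem shannonEntropy_comp {Ω κ α : Type} [MeasurableSpace Ω] (μ : Measure Ω) [IsFiniteMeasure μ]
    [Fintype κ] [Fintype α] {J : Ω → κ} (hJ : ∀ j, MeasurableSet (J ⁻¹' {j})) (Φ : κ → α) :
    shannonEntropy μ (fun ω => Φ (J ω)) =
      massEntropy (fun j => (μ (J ⁻¹' {j})).toReal) Φ := by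
  classical
  have hfib (a : α) : (μ ((fun ω => Φ (J ω)) ⁻¹' {a})).toReal =
      ∑ j, if Φ j = a then (μ (J ⁻¹' {j})).toReal else 0 := by
    have hset : (fun ω => Φ (J ω)) ⁻¹' {a} = ⋃ j ∈ Finset.univ.filter (Φ · = a), J ⁻¹' {j} := by
      ext ω
      simp
    rw [hset, ← Finset.sum_filter]
    refine measureReal_biUnion_finset (μ := μ) (fun i _ j _ hij => ?_) (fun j _ => hJ j)
    exact Set.disjoint_left.2 fun ω hi hj => hij (hi.symm.trans hj)
  unfold shannonEntropy massEntropy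
  simp_rw [hfib, Real.negMulLog, neg_mul, Finset.sum_mul, mul_neg, Finset.sum_neg_distrib]
  rw [Finset.sum_comm]
  congr 1
  refine Finset.sum_congr rfl fun j _ => ?_
  rw [Finset.sum_eq_single (Φ j) (fun a _ ha => by simp [ha.symm]) (by simp), if_pos rfl]
  unfold fiberMass
  congr! 3

namespace Scheme

attribute [instance] mΩ prob secFin shFin

/-- All shares together with the secret. -/
def joint {P : Type} [Fintype P] [DecidableEq P] (S : Scheme P) (ω : S.Ω) :
    (∀ p, S.ShT p) × S.SecT :=
  (fun p => S.share p ω, S.secret ω)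

/-- The joint mass function of all shares and the secret. -/
noncomputable def jointMass {P : Type} [Fintype P] [DecidableEq P] (S : Scheme P)
    (j : (∀ p, S.ShT p) × S.SecT) : ℝ :=
  (S.μ (S.joint ⁻¹' {j})).toReal

section Joint

variable {P : Type} [Fintype P] [DecidableEq P] (S : Scheme P)

theorem measurableSet_joint (j : (∀ p, S.ShT p) × S.SecT) :
    MeasurableSet (S.joint ⁻¹' {j}) := by
  have : S.joint ⁻¹' {j} = (⋂ p, S.share p ⁻¹' {j.1 p}) ∩ S.secret ⁻¹' {j.2} := by
    ext ω
    simp [joint, Prod.ext_iff, funext_iff]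
  rw [this]
  exact (MeasurableSet.iInter fun p => S.share_meas p _).inter (S.secret_meas _)

theorem jointMass_nonneg (j : (∀ p, S.ShT p) × S.SecT) : 0 ≤ S.jointMass j :=
  ENNReal.toReal_nonneg

theorem sum_jointMass : ∑ j, S.jointMass j = 1 := by
  classical
  have h := measureReal_biUnion_finset (μ := S.μ) (s := Finset.univ)
    (f := fun j => S.joint ⁻¹' {j})
    (fun i _ j _ hij => Set.disjoint_left.2 fun ω hi hj => hij (hi.symm.trans hj))
    (fun j _ => S.measurableSet_joint j)
  have huniv : (⋃ j ∈ (Finset.univ : Finset ((∀ p, S.ShT p) × S.SecT)), S.joint ⁻¹' {j}) =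
      Set.univ := by
    ext ω
    simp
  rw [huniv, probReal_univ] at h
  exact h.symm

theorem Hset_eq_massEntropy (X : Finset P) :
    S.Hset X = massEntropy S.jointMass (fun j => fun p : {y // y ∈ X} => j.1 p.1) :=
  shannonEntropy_comp S.μ S.measurableSet_joint fun j => fun p : {y // y ∈ X} => j.1 p.1

theorem HsetS_eq_massEntropy (X : Finset P) :
    S.HsetS X =
      massEntropy S.jointMass (fun j => ((fun p : {y // y ∈ X} => j.1 p.1), j.2)) :=
  shannonEntropy_comp S.μ S.measurableSet_joint
    fun j => ((fun p : {y // y ∈ X} => j.1 p.1), j.2)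

end Joint

/-- The variable numbered `i`, where the numbers of the participants `x` and `v₆` are exchanged
and the secret stands in for the share of the dealer `x`. -/
def portVar (S : Scheme (Fin 8)) (x : Fin 8) (i : ℕ) (j : (∀ p, S.ShT p) × S.SecT) :
    (Σ p, S.ShT p) ⊕ S.SecT :=
  if i = 5 then .inr j.2 else .inl ⟨Equiv.swap x 5 (Fin.ofNat 8 i), j.1 _⟩

/-- The participants other than the dealer `x` numbered by the set bits of `m`. -/
def portSet (x : Fin 8) (m : ℕ) : Finset (Fin 8) :=
  (Finset.univ.filter fun i : Fin 8 => i ≠ 5 ∧ m.testBit i = true).image (Equiv.swap x 5)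

theorem forall_portVar_iff (S : Scheme (Fin 8)) (x : Fin 8) {m : ℕ} (hm : m < 256)
    (j k : (∀ p, S.ShT p) × S.SecT) :
    (∀ i, i ≠ 5 → m.testBit i = true → S.portVar x i k = S.portVar x i j) ↔
      ∀ p ∈ portSet x m, k.1 p = j.1 p := by
  simp only [portSet, Finset.forall_mem_image, Finset.mem_filter, Finset.mem_univ, true_and,
    and_imp]
  constructor
  · intro h i h5 hi
    have h5' : (i : ℕ) ≠ 5 := fun h => h5 (Fin.ext h)
    have := h i h5' hi
    have he : Fin.ofNat 8 (i : ℕ) = i := Fin.ext (Nat.mod_eq_of_lt i.isLt)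
    rw [portVar, portVar, if_neg h5', if_neg h5', he] at this
    simpa using this
  · intro h i h5 hi
    have h8 : i < 8 := lt_of_testBit_of_lt hm hi
    have := @h ⟨i, h8⟩ (fun h => h5 (Fin.ext_iff.1 h)) hi
    rw [portVar, portVar, if_neg h5, if_neg h5]
    have he : Fin.ofNat 8 i = ⟨i, h8⟩ := Fin.ext (Nat.mod_eq_of_lt h8)
    rw [he, this]

theorem massEntropy_portVar (S : Scheme (Fin 8)) (x : Fin 8) {m : ℕ} (hm : m < 256)
    (h5 : m.testBit 5 = false) :
    massEntropy S.jointMass (maskVar (S.portVar x) m) = S.Hset (portSet x m) := by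
  rw [Hset_eq_massEntropy]
  refine massEntropy_congr S.jointMass_nonneg fun j k _ _ => ?_
  rw [maskVar_eq_iff, funext_iff, Subtype.forall, ← forall_portVar_iff S x hm]
  refine forall_congr' fun i => ⟨fun h _ => h, fun h hi => h ?_ hi⟩
  rintro rfl
  exact absurd (h5.symm.trans hi) (by decide)

theorem massEntropy_portVar_secret (S : Scheme (Fin 8)) (x : Fin 8) {m n : ℕ} (hm : m < 256)
    (hn : m ||| 32 = n) :
    massEntropy S.jointMass (maskVar (S.portVar x) n) = S.HsetS (portSet x m) := by
  rw [HsetS_eq_massEntropy]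
  refine massEntropy_congr S.jointMass_nonneg fun j k _ _ => ?_
  rw [maskVar_eq_iff, Prod.ext_iff, funext_iff, Subtype.forall, ← forall_portVar_iff S x hm]
  have hbit (i : ℕ) : n.testBit i = true ↔ m.testBit i = true ∨ i = 5 := by
    rw [← hn, show (32 : ℕ) = 2 ^ 5 from rfl, Nat.testBit_lor, Nat.testBit_two_pow,
      Bool.or_eq_true, decide_eq_true_eq, eq_comm (a := 5)]
  simp only [hbit]
  constructor
  · intro h
    exact ⟨fun i _ hi => h i (Or.inl hi), by simpa [portVar] using h 5 (Or.inr rfl)⟩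
  · rintro ⟨h, h'⟩ i hi
    by_cases hi5 : i = 5
    · subst hi5
      simpa [portVar] using h'
    · exact h i hi5 (hi.resolve_right hi5)

end Scheme

section VamosPort

instance : DecidablePred VamosDep := fun _ => by unfold VamosDep; infer_instance

instance : DecidablePred VamosCircuit := fun _ => by unfold VamosCircuit; infer_instance

instance (x : Fin 8) : DecidablePred (VamosQualified x) := fun _ => by
  unfold VamosQualified; infer_instance

theorem vamosQualified_portSet {x : Fin 8} (hx : x ∈ pairC) :
    ∀ m ∈ ({19, 28, 78, 195, 208} : Finset ℕ), VamosQualified x (Scheme.portSet x m) := by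
  revert x
  decide +kernel

theorem portSet_eq_singleton {x : Fin 8} (hx : x ∈ pairC) :
    ∀ m ∈ ({1, 2, 16} : Finset ℕ), ∃ i, Scheme.portSet x m = {i} := by
  revert x
  decide +kernel

theorem not_vamosQualified_portSet {x : Fin 8} (hx : x ∈ pairC) :
    ∀ m ∈ ({14, 15, 18, 76, 144, 194, 204} : Finset ℕ),
      ¬ VamosQualified x (Scheme.portSet x m) := by
  revert x
  decide +kernel

end VamosPort

/-- Among real functions of bitmasks on `10` indices, a polymatroid `g` satisfies
`1 ≤ 8 * lam` as soon as the indices `8`, `9` form a copy of `0`, `1` over `{2, 3, 4, 5}` that is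
conditionally independent of the rest, and `g` obeys the listed values of the port of the Vamos
matroid at the index `5`, with singletons of size at most `1 + lam`. -/
theorem one_le_eight_mul_of_copy (g : ℕ → ℝ) (lam : ℝ) (h0 : g 0 = 0)
    (hmono : ∀ m n, m &&& n = m → g m ≤ g n)
    (hsub : ∀ m n u v, m ||| n = u → m &&& n = v → g u + g v ≤ g m + g n)
    (hcopy : ∀ m n, m < 64 → (m &&& 60) ||| ((m &&& 3) <<< 8) = n → g n = g m)
    (hcond : g 828 + g 255 ≤ g 1023 + g 60)
    (hqual : ∀ m n, m ∈ ({19, 28, 78, 195, 208} : Finset ℕ) → m + 32 = n → g n = g m)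
    (hunqual : ∀ m n, m ∈ ({14, 15, 18, 76, 144, 194, 204} : Finset ℕ) → m + 32 = n →
      g n = g m + 1)
    (hbound : ∀ m ∈ ({1, 2, 16} : Finset ℕ), g m ≤ 1 + lam) :
    1 ≤ 8 * lam := by
  linear_combination
    hsub 1 16 17 0 rfl rfl
    + 3 * hsub 8 16 24 0 rfl rfl
    + 2 * hsub 16 512 528 0 rfl rfl
    + hsub 128 256 384 0 rfl rfl
    + hsub 128 512 640 0 rfl rfl
    + hsub 18 514 530 2 rfl rfl
    + 3 * hsub 12 24 28 8 rfl rfl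
    + hsub 13 524 525 12 rfl rfl
    + hsub 14 76 78 12 rfl rfl
    + hsub 140 268 396 12 rfl rfl
    + hsub 15 525 527 13 rfl rfl
    + hsub 17 18 19 16 rfl rfl
    + hsub 110 302 366 46 rfl rfl
    + 3 * hsub 63 111 127 47 rfl rfl
    + hsub 51 306 307 50 rfl rfl
    + hsub 110 620 622 108 rfl rfl
    + hsub 126 622 638 110 rfl rfl
    + 3 * hsub 127 239 255 111 rfl rfl
    + hsub 254 382 510 126 rfl rfl
    + hsub 144 192 208 128 rfl rfl
    + hsub 384 640 896 128 rfl rfl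
    + hsub 204 396 460 140 rfl rfl
    + hsub 240 432 496 176 rfl rfl
    + hsub 194 448 450 192 rfl rfl
    + hsub 227 707 739 195 rfl rfl
    + hsub 230 738 742 226 rfl rfl
    + hsub 231 238 239 230 rfl rfl
    + hsub 239 743 751 231 rfl rfl
    + hsub 237 748 749 236 rfl rfl
    + hsub 239 493 495 237 rfl rfl
    + hsub 239 750 751 238 rfl rfl
    + 5 * hsub 255 751 767 239 rfl rfl
    + hsub 255 766 767 254 rfl rfl
    + hsub 332 780 844 268 rfl rfl
    + hsub 318 366 382 302 rfl rfl
    + hsub 307 818 819 306 rfl rfl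
    + hsub 382 830 894 318 rfl rfl
    + hsub 460 844 972 332 rfl rfl
    + hsub 510 894 1022 382 rfl rfl
    + hsub 496 944 1008 432 rfl rfl
    + hsub 450 960 962 448 rfl rfl
    + hsub 495 1005 1007 493 rfl rfl
    + hsub 528 640 656 512 rfl rfl
    + hsub 530 770 786 514 rfl rfl
    + hsub 525 780 781 524 rfl rfl
    + hsub 527 781 783 525 rfl rfl
    + hsub 636 748 764 620 rfl rfl
    + hsub 638 892 894 636 rfl rfl
    + hsub 656 896 912 640 rfl rfl
    + hsub 739 963 995 707 rfl rfl
    + hsub 742 994 998 738 rfl rfl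
    + hsub 751 999 1007 743 rfl rfl
    + hsub 749 1004 1005 748 rfl rfl
    + hsub 750 764 766 748 rfl rfl
    + 2 * hsub 751 1006 1007 750 rfl rfl
    + 6 * hsub 767 1007 1023 751 rfl rfl
    + hsub 771 898 899 770 rfl rfl
    + hsub 779 787 795 771 rfl rfl
    + hsub 783 811 815 779 rfl rfl
    + hsub 786 816 818 784 rfl rfl
    + hsub 816 912 944 784 rfl rfl
    + hsub 795 819 827 787 rfl rfl
    + hsub 815 827 831 811 rfl rfl
    + hsub 831 894 895 830 rfl rfl
    + hsub 894 1020 1022 892 rfl rfl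
    + hsub 895 1022 1023 894 rfl rfl
    + hsub 899 962 963 898 rfl rfl
    + hsub 964 976 980 960 rfl rfl
    + hsub 972 980 988 964 rfl rfl
    + hsub 984 1008 1016 976 rfl rfl
    + hsub 988 1016 1020 984 rfl rfl
    + hsub 995 998 999 994 rfl rfl
    + hsub 1005 1020 1021 1004 rfl rfl
    + hsub 1007 1021 1023 1005 rfl rfl
    + 2 * hsub 1007 1022 1023 1006 rfl rfl
    + hsub 1021 1022 1023 1020 rfl rfl
    + 2 * hmono 1022 1023 rfl
    + hmono 1021 1023 rfl
    + 5 * hmono 1007 1023 rfl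
    + 3 * hcond
    + 2 * hbound 1 (by decide)
    + hbound 2 (by decide)
    + 5 * hbound 16 (by decide)
    + hcopy 1 256 (by decide) rfl
    + 2 * hcopy 2 512 (by decide) rfl
    + 2 * hcopy 15 780 (by decide) rfl
    - hcopy 18 528 (by decide) rfl
    - 2 * hcopy 19 784 (by decide) rfl
    + 2 * hcopy 51 816 (by decide) rfl
    - 3 * hcopy 63 828 (by decide) rfl
    - hunqual 14 46 (by decide) rfl
    - 3 * hunqual 15 47 (by decide) rfl
    - hunqual 18 50 (by decide) rfl
    + 3 * hqual 19 51 (by decide) rfl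
    + 3 * hqual 28 60 (by decide) rfl
    - hunqual 76 108 (by decide) rfl
    + hqual 78 110 (by decide) rfl
    - hunqual 144 176 (by decide) rfl
    - hunqual 194 226 (by decide) rfl
    + hqual 195 227 (by decide) rfl
    - hunqual 204 236 (by decide) rfl
    + hqual 208 240 (by decide) rfl
    - 8 * h0

/-- If the dealer is a member of the Vamos pair `C`, then `2/17 ≤ λ`. -/
theorem dealer_in_C_lam (x : Fin 8) (hx : x ∈ pairC)
    (S : Scheme (Fin 8)) (hperf : S.IsPerfect (VamosQualified x)) (hpos : 0 < S.Hsec) :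
    2 / 17 ≤ S.lam := by
  set p := S.jointMass
  set X := S.portVar x
  have hp : ∀ j, 0 ≤ p j := S.jointMass_nonneg
  set q := copyMass p (maskVar X 60)
  have hq : ∀ w, 0 ≤ q w := copyMass_nonneg hp _
  set g : ℕ → ℝ := fun m => massEntropy q (maskVar (copyVar X) m) / S.Hsec with hg
  have hdiv {a b : ℝ} (h : a ≤ b) : a / S.Hsec ≤ b / S.Hsec := by gcongr
  have hbase {m : ℕ} (hm : m < 256) : g m = massEntropy p (maskVar X m) / S.Hsec := by
    rw [hg]
    exact congrArg (· / S.Hsec) (massEntropy_copyVar_base hp hm)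
  have hset {m : ℕ} (hm : m < 256) (h5 : m.testBit 5 = false) :
      g m = S.Hset (Scheme.portSet x m) / S.Hsec := by
    rw [hbase hm, S.massEntropy_portVar x hm h5]
  have hsetS {m n : ℕ} (hm : m < 256) (hn : n < 256)
      (hmn : m ||| 32 = n) : g n = S.HsetS (Scheme.portSet x m) / S.Hsec := by
    rw [hbase hn, S.massEntropy_portVar_secret x hm hmn]
  have hcopy {m n : ℕ} (hm : m < 64) (hn : (m &&& 60) ||| ((m &&& 3) <<< 8) = n) :
      g n = massEntropy p (maskVar X m) / S.Hsec :=
    congrArg (· / S.Hsec) (massEntropy_copyVar_copy hp hm hn)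
  have key : 1 ≤ 8 * S.lam := by
    refine one_le_eight_mul_of_copy g S.lam ?_ ?_ ?_ ?_ ?_ ?_ ?_ ?_
    · rw [hbase (by decide), massEntropy_maskVar_zero S.sum_jointMass, zero_div]
    · exact fun m n h => hdiv (massEntropy_maskVar_mono hq h)
    · intro m n u v hu hv
      simp only [hg, ← add_div]
      exact hdiv (massEntropy_maskVar_submodular hq hu hv)
    · exact fun m n hm hn => (hcopy hm hn).trans (hbase (by lia)).symm
    · rw [hcopy (m := 63) (n := 828) (by decide) rfl, hbase (m := 255) (by decide),
        hbase (m := 60) (by decide), ← add_div]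
      simp only [hg, ← add_div]
      exact hdiv (massEntropy_copyVar_condIndep hp)
    · rintro m n hm rfl
      obtain ⟨h1, h2, h3, h4⟩ := (by decide : ∀ m ∈ ({19, 28, 78, 195, 208} : Finset ℕ),
        m < 256 ∧ m + 32 < 256 ∧ m.testBit 5 = false ∧ m ||| 32 = m + 32) m hm
      rw [hset h1 h3, hsetS h1 h2 h4,
        sub_eq_zero.1 (hperf.1 _ (vamosQualified_portSet hx m hm))]
    · rintro m n hm rfl
      obtain ⟨h1, h2, h3, h4⟩ := (by decide : ∀ m ∈ ({14, 15, 18, 76, 144, 194, 204} : Finset ℕ),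
        m < 256 ∧ m + 32 < 256 ∧ m.testBit 5 = false ∧ m ||| 32 = m + 32) m hm
      rw [hset h1 h3, hsetS h1 h2 h4,
        sub_eq_iff_eq_add'.1 (hperf.2 _ (not_vamosQualified_portSet hx m hm)), add_div,
        div_self hpos.ne']
    · intro m hm
      obtain ⟨h1, h2⟩ := (by decide : ∀ m ∈ ({1, 2, 16} : Finset ℕ),
        m < 256 ∧ m.testBit 5 = false) m hm
      obtain ⟨i, hi⟩ := portSet_eq_singleton hx m hm
      rw [hset h1 h2, hi, Scheme.lam, add_sub_cancel]
      exact Finset.le_sup' (fun i => S.hset {i}) (Finset.mem_univ i)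
  linarith
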